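/- Suppose that for every x ∈ X, P_x-almost every trajectory ω ∈ X^ℕ leaves the set Φ\Ψ in finite time (i.e. τ∧τ' < ∞ almost surely, where τ is the first hitting time of Ψ and τ' is the first hitting time of X \ (Φ ∪ Ψ)). Then for every u ∈ M_b^{01}(Φ,Ψ) satisfying u(x) ≤ L[u](x) for all x ∈ X, one has u(x) ≤ V(x) for all x ∈ X. -/

import Mathlib

open MeasureTheory ProbabilityTheory Filter

/-- The operator `L[W](x) = 1_Ψ(x) + 1_{Φ\Ψ}(x) ∫_X W(ξ) Q(x,dξ)`. -/
noncomputable def Lop {X : Type*} [MeasurableSpace X] (Q : Kernel X X) (Φ Ψ : Set X)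
    (W : X → ℝ) (x : X) : ℝ :=
  Ψ.indicator (fun _ => (1 : ℝ)) x + (Φ \ Ψ).indicator (fun _ => ∫ ξ, W ξ ∂(Q x)) x

/-- The set `M_b^{01}(Φ,Ψ)`. -/
def Mb01 {X : Type*} [MeasurableSpace X] (Φ Ψ : Set X) : Set (X → ℝ) :=
  {W | Measurable W ∧ (∃ C, ∀ x, |W x| ≤ C) ∧ (∀ x, 0 ≤ W x) ∧ (∀ x, W x ≤ 1) ∧
    (∀ x ∈ Ψ, W x = 1) ∧ ∀ x ∈ (Φ ∪ Ψ)ᶜ, W x = 0}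

/-- The iterates `V_0 = 1_Ψ`, `V_{k+1} = L[V_k]`. -/
noncomputable def Vseq {X : Type*} [MeasurableSpace X] (Q : Kernel X X) (Φ Ψ : Set X) :
    ℕ → X → ℝ
  | 0 => Ψ.indicator (fun _ => (1 : ℝ))
  | (k + 1) => Lop Q Φ Ψ (Vseq Q Φ Ψ k)

/-- The probability assigned by the Markov chain with kernel `Q` started at `δ_x` to the
cylinder set `{ω | ω 0 ∈ B 0, …, ω n ∈ B n}`, defined by the iterated integrals of
Ionescu-Tulcea: `cylProb Q 0 B x = 1_{B 0}(x)` and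
`cylProb Q (n+1) B x = 1_{B 0}(x) ∫_X cylProb Q n (B ∘ (·+1)) ξ Q(x,dξ)`. -/
noncomputable def cylProb {X : Type*} [MeasurableSpace X] (Q : Kernel X X) :
    ℕ → (ℕ → Set X) → X → ENNReal
  | 0 => fun B x => (B 0).indicator (fun _ => (1 : ENNReal)) x
  | (n + 1) => fun B x =>
      (B 0).indicator (fun _ => ∫⁻ ξ, cylProb Q n (fun i => B (i + 1)) ξ ∂(Q x)) x

/-- The first hitting time of the set `S` by the trajectory `ω`, with value `⊤` (i.e.
`∞`) if `S` is never visited. -/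
noncomputable def hitTime {X : Type*} (S : Set X) (ω : ℕ → X) : ℕ∞ :=
  sInf (Set.image (fun n : ℕ => (n : ℕ∞)) {n : ℕ | ω n ∈ S})
theorem cyl_aux {X : Type*} [MeasurableSpace X] (Q : Kernel X X) [IsMarkovKernel Q]
    (A : Set X) (hA : MeasurableSet A) (n : ℕ) :
    Measurable (cylProb Q n (fun _ => A)) ∧ ∀ x, cylProb Q n (fun _ => A) x ≤ 1 := by
  induction n with
  | zero =>
    refine ⟨measurable_const.indicator hA, fun x => ?_⟩
    by_cases hx : x ∈ A <;> simp [cylProb, hx]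
  | succ n ih =>
    refine ⟨?_, fun x => ?_⟩
    · exact (Measurable.lintegral_kernel (κ := Q) ih.1).indicator hA
    · have h : ∫⁻ ξ, cylProb Q n (fun _ => A) ξ ∂(Q x) ≤ 1 := by
        calc ∫⁻ ξ, cylProb Q n (fun _ => A) ξ ∂(Q x) ≤ ∫⁻ _, 1 ∂(Q x) := lintegral_mono ih.2
          _ = 1 := by simp
      by_cases hx : x ∈ A <;> simp [cylProb, hx, h]

theorem Vseq_aux {X : Type*} [MeasurableSpace X] (Q : Kernel X X) [IsMarkovKernel Q]
    (Φ Ψ : Set X) (hΦ : MeasurableSet Φ) (hΨ : MeasurableSet Ψ) (n : ℕ) :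
    Measurable (Vseq Q Φ Ψ n) ∧ ∀ x, 0 ≤ Vseq Q Φ Ψ n x ∧ Vseq Q Φ Ψ n x ≤ 1 := by
  induction n with
  | zero =>
    refine ⟨measurable_const.indicator hΨ, fun x => ?_⟩
    by_cases hx : x ∈ Ψ <;> simp [Vseq, hx]
  | succ n ih =>
    obtain ⟨hm, hb⟩ := ih
    refine ⟨?_, fun x => ?_⟩
    · refine (measurable_const.indicator hΨ).add ?_
      exact (StronglyMeasurable.integral_kernel (κ := Q)
        hm.stronglyMeasurable).measurable.indicator (hΦ.diff hΨ)
    · have h0 : 0 ≤ ∫ ξ, Vseq Q Φ Ψ n ξ ∂(Q x) := integral_nonneg fun y => (hb y).1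
      have h1 : ∫ ξ, Vseq Q Φ Ψ n ξ ∂(Q x) ≤ 1 := by
        calc ∫ ξ, Vseq Q Φ Ψ n ξ ∂(Q x) ≤ ∫ _, (1 : ℝ) ∂(Q x) :=
              integral_mono_of_nonneg (Eventually.of_forall fun y => (hb y).1)
                (integrable_const _) (Eventually.of_forall fun y => (hb y).2)
          _ = 1 := by simp
      by_cases hx : x ∈ Ψ
      · simp [Vseq, Lop, hx]
      · by_cases hx' : x ∈ Φ <;> simp [Vseq, Lop, hx, hx', h0, h1]

theorem le_Vseq_add {X : Type*} [MeasurableSpace X] (Q : Kernel X X) [IsMarkovKernel Q]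
    (Φ Ψ : Set X) (hΦ : MeasurableSet Φ) (hΨ : MeasurableSet Ψ)
    (u : X → ℝ) (hu : u ∈ Mb01 Φ Ψ) (huL : ∀ x, u x ≤ Lop Q Φ Ψ u x) (n : ℕ) :
    ∀ x, u x ≤ Vseq Q Φ Ψ n x + (cylProb Q n (fun _ => Φ \ Ψ) x).toReal := by
  obtain ⟨um, -, u0, u1, uΨ, uc⟩ := hu
  induction n with
  | zero =>
    intro x
    by_cases hx : x ∈ Ψ
    · simp [Vseq, cylProb, hx, u1]
    · by_cases hx' : x ∈ Φ
      · simp [Vseq, cylProb, hx, hx', u1]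
      · simp [Vseq, cylProb, hx, hx', uc x (by simp [hx, hx'])]
  | succ n ih =>
    intro x
    obtain ⟨cm, c1⟩ := cyl_aux Q (Φ \ Ψ) (hΦ.diff hΨ) n
    obtain ⟨vm, vb⟩ := Vseq_aux Q Φ Ψ hΦ hΨ n
    by_cases hx : x ∈ Ψ
    · simp [Vseq, Lop, cylProb, hx, u1]
    · by_cases hx' : x ∈ Φ
      · have h := huL x
        simp only [Lop, Set.indicator, Set.mem_sdiff, hx, hx', if_true, if_false, zero_add,
          not_false_eq_true, and_self] at h
        simp only [Vseq, Lop, cylProb, Set.indicator, Set.mem_sdiff, hx, hx', if_true, if_false,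
          zero_add, not_false_eq_true, and_self]
        have ui : Integrable u (Q x) := Integrable.of_bound um.aestronglyMeasurable 1
          (Eventually.of_forall fun y => by
            rw [Real.norm_eq_abs, abs_of_nonneg (u0 y)]; exact u1 y)
        have vi : Integrable (Vseq Q Φ Ψ n) (Q x) := Integrable.of_bound vm.aestronglyMeasurable 1
          (Eventually.of_forall fun y => by
            rw [Real.norm_eq_abs, abs_of_nonneg (vb y).1]; exact (vb y).2)
        have ci : Integrable (fun y => (cylProb Q n (fun _ => Φ \ Ψ) y).toReal) (Q x) :=
          Integrable.of_bound cm.ennreal_toReal.aestronglyMeasurable 1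
          (Eventually.of_forall fun y => by
            rw [Real.norm_eq_abs, abs_of_nonneg ENNReal.toReal_nonneg]
            exact ENNReal.toReal_mono ENNReal.one_ne_top (c1 y))
        refine h.trans ?_
        rw [← integral_toReal cm.aemeasurable
          (Eventually.of_forall fun y => (c1 y).trans_lt ENNReal.one_lt_top),
          ← integral_add vi ci]
        exact integral_mono ui (vi.add ci) ih
      · simp [Vseq, Lop, cylProb, hx, hx', uc x (by simp [hx, hx'])]

/-- If `τ ∧ τ' < ∞` `P_x`-almost surely for every `x` (where `τ`, `τ'` are the first
hitting times of `Ψ` and of `X \ (Φ ∪ Ψ)`), then every `u ∈ M_b^{01}(Φ,Ψ)` with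
`u ≤ L[u]` satisfies `u ≤ V` pointwise. -/
theorem le_V_of_le_Lop {X : Type*} [MeasurableSpace X] [StandardBorelSpace X] [Nonempty X]
    (Q : Kernel X X) [IsMarkovKernel Q]
    (Φ Ψ : Set X) (hΦ : MeasurableSet Φ) (hΨ : MeasurableSet Ψ)
    (P : X → Measure (ℕ → X)) [∀ x, IsProbabilityMeasure (P x)]
    (hP : ∀ (x : X) (n : ℕ) (B : ℕ → Set X), (∀ i, MeasurableSet (B i)) →
      P x {ω : ℕ → X | ∀ i ≤ n, ω i ∈ B i} = cylProb Q n B x)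
    (hfin : ∀ x : X, ∀ᵐ ω ∂(P x), min (hitTime Ψ ω) (hitTime ((Φ ∪ Ψ)ᶜ) ω) < ⊤)
    (V : X → ℝ) (hV : ∀ x, Tendsto (fun k => Vseq Q Φ Ψ k x) atTop (nhds (V x)))
    (u : X → ℝ) (hu : u ∈ Mb01 Φ Ψ) (huL : ∀ x, u x ≤ Lop Q Φ Ψ u x) :
    ∀ x, u x ≤ V x := by
  intro x
  have hA : MeasurableSet (Φ \ Ψ) := hΦ.diff hΨ
  have hlim : Tendsto (fun n => cylProb Q n (fun _ => Φ \ Ψ) x) atTop (nhds 0) := by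
    have hms : ∀ n : ℕ, MeasurableSet {ω : ℕ → X | ∀ i ≤ n, ω i ∈ Φ \ Ψ} := by
      intro n
      simp only [Set.ofPred_forall]
      exact MeasurableSet.iInter fun i => MeasurableSet.iInter fun _ =>
        measurable_pi_apply i hA
    have h := tendsto_measure_iInter_atTop (μ := P x)
      (s := fun n : ℕ => {ω : ℕ → X | ∀ i ≤ n, ω i ∈ Φ \ Ψ})
      (fun n => (hms n).nullMeasurableSet)
      (fun m n hmn ω hω i hi => hω i (hi.trans hmn)) ⟨0, measure_ne_top _ _⟩
    have hz : P x (⋂ n : ℕ, {ω : ℕ → X | ∀ i ≤ n, ω i ∈ Φ \ Ψ}) = 0 := by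
      refine measure_mono_null ?_ (hfin x)
      intro ω hω
      have hω' : ∀ n, ω n ∈ Φ \ Ψ := fun n => Set.mem_iInter.1 hω n n le_rfl
      have e1 : hitTime Ψ ω = ⊤ := by
        have : {n : ℕ | ω n ∈ Ψ} = ∅ := Set.eq_empty_of_forall_notMem fun n hn => (hω' n).2 hn
        simp [hitTime, this]
      have e2 : hitTime ((Φ ∪ Ψ)ᶜ) ω = ⊤ := by
        have : {n : ℕ | ω n ∈ (Φ ∪ Ψ)ᶜ} = ∅ :=
          Set.eq_empty_of_forall_notMem fun n hn => hn (Or.inl (hω' n).1)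
        rw [hitTime, this]; simp
      rw [Set.mem_compl_iff]
      intro hlt
      have hlt2 : min (hitTime Ψ ω) (hitTime ((Φ ∪ Ψ)ᶜ) ω) < ⊤ := hlt
      rw [e1, e2, min_self] at hlt2
      exact lt_irrefl _ hlt2
    rw [hz] at h
    refine h.congr fun n => ?_
    exact hP x n (fun _ => Φ \ Ψ) fun _ => hA
  have hlim' := (ENNReal.tendsto_toReal ENNReal.zero_ne_top).comp hlim
  have := (hV x).add hlim'
  rw [ENNReal.toReal_zero, add_zero] at this
  exact ge_of_tendsto' this fun n => le_Vseq_add Q Φ Ψ hΦ hΨ u hu huL n x
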